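/- Let $\rho > 2$, $0 < s < 1/2$, $\overline{W}, c_s > 0$, and define block weights $W_{B_j,B_k} = 2^{j+k}\overline{W}(2\rho)^{-(j\vee k)-1}$ for $0 \le j < k \le n-1$ and $W_{B_j,\delta_n} = 2^j\overline{W}\rho^{-n}/(2(\rho-1))$ (with $B_n = \delta_n$), and $W_{B_{k'},B_k} = 2^{2k}\overline{W}(2\rho)^{-k-1}$. Then there is a constant $C = C(\overline{W},\rho,s)$, independent of $n$ and $k$, such that $\sum_{k=k_0 < k_1 < \cdots < k_\ell = n} \prod_{i=0}^{\ell-1}\big[(1 + c_s^s W_{B_{k_i'},B_{k_i}}^s)\, c_s^s\, W_{B_{k_i},B_{k_{i+1}}}^s\big] \le C\, \rho^{-s(n-k)}$. -/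

import Mathlib

open scoped Classical

/-- Sum over strictly increasing sequences `k = k₀ < ⋯ < k_ℓ = n` (lengths `ℓ ≥ 1`) of
`∏_{i=0}^{ℓ-1} F (k_i) (k_{i+1})`. -/
noncomputable def chainSum (k n : ℕ) (F : ℕ → ℕ → ℝ) : ℝ :=
  ∑ ℓ ∈ Finset.Icc 1 (n - k),
    ∑ f ∈ Finset.univ.filter
        (fun f : Fin (ℓ + 1) → Fin (n + 1) =>
          StrictMono f ∧ (f 0 : ℕ) = k ∧ (f (Fin.last ℓ) : ℕ) = n),
      ∏ i : Fin ℓ, F (f i.castSucc) (f i.succ)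

/-- Coarse-grained block weights: `W_{B_a,B_b} = 2^{a+b} W̄ (2ρ)^{-(b+1)}` for `a < b < n`,
and `W_{B_a,δ_n} = 2^a W̄ ρ^{-n}/(2(ρ-1))` (with `B_n = δ_n`). -/
noncomputable def WBρ (ρ Wbar : ℝ) (n a b : ℕ) : ℝ :=
  if b = n then 2 ^ a * Wbar * (ρ⁻¹) ^ n / (2 * (ρ - 1))
  else 2 ^ (a + b) * Wbar * ((2 * ρ)⁻¹) ^ (b + 1)

/-- The increments of a monotone finite sequence of natural numbers telescope. -/
theorem sum_sub_eq_of_monotone {l : ℕ} {f : Fin (l + 1) → ℕ} (hf : Monotone f) :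
    ∑ i : Fin l, (f i.succ - f i.castSucc) = f (Fin.last l) - f 0 := by
  induction l with
  | zero => simp
  | succ l ih =>
    have h := ih (f := fun i => f i.castSucc) (fun i j hij => hf (by simpa using hij))
    rw [Fin.sum_univ_castSucc]
    simp only [← Fin.succ_castSucc] at h ⊢
    rw [h]
    have h1 : f 0 ≤ f (Fin.last l).castSucc := hf (Fin.zero_le _)
    have h2 : f (Fin.last l).castSucc ≤ f (Fin.last l).succ := hf (Fin.castSucc_le_succ _)
    simp only [Fin.castSucc_zero, Fin.succ_last, Nat.succ_eq_add_one] at *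
    omega

/-- A sum over strictly increasing sequences of length `l` ending at `n` of products of `g` is
bounded by the corresponding elementary symmetric sum. -/
theorem sum_strictMono_prod_le {g : ℕ → ℝ} (hg : ∀ a, 0 ≤ g a) (k n l : ℕ) :
    ∑ f ∈ Finset.univ.filter
        (fun f : Fin (l + 1) → Fin (n + 1) =>
          StrictMono f ∧ (f 0 : ℕ) = k ∧ (f (Fin.last l) : ℕ) = n),
      ∏ i : Fin l, g (f i.castSucc) ≤
    ∑ S ∈ Finset.powersetCard l (Finset.range n), ∏ a ∈ S, g a := by
  set A := Finset.univ.filter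
        (fun f : Fin (l + 1) → Fin (n + 1) =>
          StrictMono f ∧ (f 0 : ℕ) = k ∧ (f (Fin.last l) : ℕ) = n)
    with hA
  let φ : (Fin (l + 1) → Fin (n + 1)) → Finset ℕ :=
    fun f => Finset.univ.image fun i : Fin l => (f i.castSucc : ℕ)
  have hmono : ∀ f : Fin (l + 1) → Fin (n + 1), StrictMono f →
      StrictMono fun i : Fin l => (f i.castSucc : ℕ) :=
    fun f hf i j hij => hf (Fin.castSucc_lt_castSucc_iff.mpr hij)
  have hinj : Set.InjOn φ A := by
    intro f hf f' hf' h
    simp only [hA, Finset.mem_coe, Finset.mem_filter, Finset.mem_univ, true_and] at hf hf'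
    have hr := congrArg (fun S : Finset ℕ => (S : Set ℕ)) h
    simp only [φ, Finset.coe_image, Finset.coe_univ, Set.image_univ] at hr
    have he := ((hmono f hf.1).range_inj (hmono f' hf'.1)).mp hr
    funext i
    refine Fin.lastCases ?_ (fun j => ?_) i
    · exact Fin.ext (hf.2.2.trans hf'.2.2.symm)
    · exact Fin.ext (congrFun he j)
  calc _ = ∑ f ∈ A, ∏ a ∈ φ f, g a := by
        refine Finset.sum_congr rfl fun f hf => ?_
        rw [Finset.prod_image fun i _ j _ h =>
          (hmono f (Finset.mem_filter.mp hf).2.1).injective h]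
    _ = ∑ S ∈ A.image φ, ∏ a ∈ S, g a := by rw [Finset.sum_image hinj]
    _ ≤ _ := by
        refine Finset.sum_le_sum_of_subset_of_nonneg ?_
          fun S _ _ => Finset.prod_nonneg fun a _ => hg a
        intro S hS
        obtain ⟨f, hf, rfl⟩ := Finset.mem_image.mp hS
        obtain ⟨hf, -, hn⟩ := (Finset.mem_filter.mp hf).2
        refine Finset.mem_powersetCard.mpr ⟨fun a ha => ?_, ?_⟩
        · obtain ⟨i, -, rfl⟩ := Finset.mem_image.mp ha
          have : (f i.castSucc : ℕ) < f (Fin.last l) := hf (Fin.castSucc_lt_last i)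
          exact Finset.mem_range.mpr (by omega)
        · rw [Finset.card_image_of_injective _ (hmono f hf).injective, Finset.card_fin]

/-- If the weights factor, up to an upper bound, through the starting point of a jump and a
geometric factor in its length, then the chain sum decays geometrically. -/
theorem chainSum_le_pow_mul_prod {F : ℕ → ℕ → ℝ} {g : ℕ → ℝ} {r : ℝ} (hr : 0 ≤ r)
    (hg : ∀ a, 0 ≤ g a) (hF0 : ∀ a b, 0 ≤ F a b)
    (hF : ∀ a b, a < b → F a b ≤ g a * r ^ (b - a)) (k n : ℕ) :
    chainSum k n F ≤ r ^ (n - k) * ∏ a ∈ Finset.range n, (1 + g a) := by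
  have hsym : ∀ l, 0 ≤ ∑ S ∈ Finset.powersetCard l (Finset.range n), ∏ a ∈ S, g a :=
    fun l => Finset.sum_nonneg fun S _ => Finset.prod_nonneg fun a _ => hg a
  calc chainSum k n F
      ≤ ∑ l ∈ Finset.Icc 1 (n - k),
          r ^ (n - k) * ∑ S ∈ Finset.powersetCard l (Finset.range n), ∏ a ∈ S, g a := by
        refine Finset.sum_le_sum fun l _ => ?_
        refine le_trans ?_ (mul_le_mul_of_nonneg_left (sum_strictMono_prod_le hg k n l)
          (pow_nonneg hr _))
        rw [Finset.mul_sum]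
        refine Finset.sum_le_sum fun f hf => ?_
        obtain ⟨hf, h0, hn⟩ := (Finset.mem_filter.mp hf).2
        have htel := sum_sub_eq_of_monotone (f := fun i => (f i : ℕ))
          fun i j hij => hf.monotone hij
        calc ∏ i : Fin l, F (f i.castSucc) (f i.succ)
            ≤ ∏ i : Fin l, (g (f i.castSucc) * r ^ ((f i.succ : ℕ) - f i.castSucc)) :=
              Finset.prod_le_prod (fun i _ => hF0 _ _)
                fun i _ => hF _ _ (hf (Fin.castSucc_lt_succ))
          _ = r ^ (n - k) * ∏ i : Fin l, g (f i.castSucc) := by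
              rw [Finset.prod_mul_distrib, Finset.prod_pow_eq_pow_sum, htel, h0, hn, mul_comm]
    _ ≤ ∑ l ∈ Finset.range (n + 1),
          r ^ (n - k) * ∑ S ∈ Finset.powersetCard l (Finset.range n), ∏ a ∈ S, g a := by
        refine Finset.sum_le_sum_of_subset_of_nonneg (fun l hl => ?_)
          fun l _ _ => mul_nonneg (pow_nonneg hr _) (hsym l)
        simp only [Finset.mem_Icc, Finset.mem_range] at hl ⊢
        omega
    _ = r ^ (n - k) * ∏ a ∈ Finset.range n, (1 + g a) := by
        rw [← Finset.mul_sum, Finset.prod_one_add, Finset.sum_powerset, Finset.card_range]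

/-- Finite products of `1 + D * γ ^ a` are bounded uniformly in the number of factors. -/
theorem prod_one_add_geometric_le {D γ : ℝ} (hD : 0 ≤ D) (hγ0 : 0 ≤ γ) (hγ1 : γ < 1) (n : ℕ) :
    ∏ a ∈ Finset.range n, (1 + D * γ ^ a) ≤ Real.exp (D * (1 - γ)⁻¹) := by
  calc ∏ a ∈ Finset.range n, (1 + D * γ ^ a)
      ≤ ∏ a ∈ Finset.range n, Real.exp (D * γ ^ a) :=
        Finset.prod_le_prod (fun a _ => by positivity)
          fun a _ => by linarith [Real.add_one_le_exp (D * γ ^ a)]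
    _ = Real.exp (D * ∑ a ∈ Finset.range n, γ ^ a) := by rw [← Real.exp_sum, Finset.mul_sum]
    _ ≤ Real.exp (D * (1 - γ)⁻¹) := by
        rw [← tsum_geometric_of_lt_one hγ0 hγ1]
        gcongr
        exact (summable_geometric_of_lt_one hγ0 hγ1).sum_le_tsum _ fun a _ => pow_nonneg hγ0 a

theorem coarse_weight_eq {ρ : ℝ} (hρ : 0 < ρ) (Wbar : ℝ) (a b : ℕ) :
    2 ^ (a + b) * Wbar * ((2 * ρ)⁻¹) ^ (b + 1) = Wbar / (2 * ρ) * (2 ^ a * (ρ⁻¹) ^ b) := by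
  rw [mul_inv, mul_pow, pow_add, pow_succ, pow_succ, inv_pow, inv_pow]
  field_simp

theorem WBρ_nonneg {ρ Wbar : ℝ} (hρ : 1 < ρ) (hW : 0 ≤ Wbar) (n a b : ℕ) :
    0 ≤ WBρ ρ Wbar n a b := by
  have : 0 < ρ - 1 := by linarith
  have : 0 < ρ := by linarith
  unfold WBρ
  split_ifs <;> positivity

theorem div_two_mul_le {ρ Wbar : ℝ} (hρ : 1 < ρ) (hW : 0 ≤ Wbar) :
    Wbar / (2 * ρ) ≤ Wbar / (2 * (ρ - 1)) :=
  div_le_div_of_nonneg_left hW (by linarith) (by linarith)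

theorem WBρ_le {ρ Wbar : ℝ} (hρ : 1 < ρ) (hW : 0 ≤ Wbar) (n : ℕ) {a b : ℕ} (hab : a ≤ b) :
    WBρ ρ Wbar n a b ≤ Wbar / (2 * (ρ - 1)) * (2 / ρ) ^ a * (ρ⁻¹) ^ (b - a) := by
  have hρ0 : 0 < ρ := by linarith
  have hsplit : (2 / ρ) ^ a * (ρ⁻¹) ^ (b - a) = 2 ^ a * (ρ⁻¹) ^ b := by
    obtain ⟨c, rfl⟩ := Nat.exists_eq_add_of_le hab
    rw [Nat.add_sub_cancel_left, div_eq_mul_inv, mul_pow, pow_add, mul_assoc]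
  rw [mul_assoc, hsplit, WBρ]
  split_ifs with h
  · subst h
    exact le_of_eq (by ring)
  · rw [coarse_weight_eq hρ0]
    exact mul_le_mul_of_nonneg_right (div_two_mul_le hρ hW) (by positivity)

/-- Subcritical dimension (`ρ > 2`): there is a constant `C = C(W̄, ρ, s)`, independent of
`n` and `k`, such that the sum over increasing jump sequences from `k` to `n` of
`∏ (1 + c_s^s W_{B_{k_i'},B_{k_i}}^s) c_s^s W_{B_{k_i},B_{k_{i+1}}}^s` (where
`W_{B_{k'},B_k} = 2^{2k} W̄ (2ρ)^{-(k+1)}`) is at most `C ρ^{-s(n-k)}`. -/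
theorem chain_sum_bound_subcritical (s ρ cs Wbar : ℝ) (hs0 : 0 < s) (hs : s < 1 / 2)
    (hρ : 2 < ρ) (hcs : 0 < cs) (hW : 0 < Wbar) :
    ∃ C : ℝ, ∀ n k : ℕ, k ≤ n →
      chainSum k n (fun a b =>
          (1 + cs ^ s * (2 ^ (2 * a) * Wbar * ((2 * ρ)⁻¹) ^ (a + 1)) ^ s) * cs ^ s *
            (WBρ ρ Wbar n a b) ^ s)
        ≤ C * ρ ^ (-(s * ((n - k : ℕ) : ℝ))) := by
  have hρ0 : 0 < ρ := by linarith
  have hρ1 : 0 < ρ - 1 := by linarith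
  set M : ℝ := Wbar / (2 * (ρ - 1))
  have hM0 : 0 < M := by positivity
  have hq0 : 0 < 2 / ρ := by positivity
  have hq1 : 2 / ρ < 1 := (div_lt_one hρ0).mpr hρ
  set D : ℝ := (1 + cs ^ s * M ^ s) * cs ^ s * M ^ s with hD
  have hD0 : 0 ≤ D := by positivity
  have hself : ∀ a : ℕ, 2 ^ (2 * a) * Wbar * ((2 * ρ)⁻¹) ^ (a + 1) ≤ M := fun a => by
    rw [two_mul a, coarse_weight_eq hρ0, ← mul_pow, ← div_eq_mul_inv]
    calc Wbar / (2 * ρ) * (2 / ρ) ^ a ≤ Wbar / (2 * ρ) * 1 := by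
          gcongr
          exact pow_le_one₀ hq0.le hq1.le
      _ ≤ M := by rw [mul_one]; exact div_two_mul_le (by linarith) hW.le
  refine ⟨Real.exp (D * (1 - (2 / ρ) ^ s)⁻¹), fun n k _ => ?_⟩
  have hWB := WBρ_nonneg (by linarith : 1 < ρ) hW.le n
  have hchain := chainSum_le_pow_mul_prod (r := (ρ⁻¹) ^ s) (g := fun a => D * ((2 / ρ) ^ s) ^ a)
    (F := fun a b => (1 + cs ^ s * (2 ^ (2 * a) * Wbar * ((2 * ρ)⁻¹) ^ (a + 1)) ^ s) * cs ^ s *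
            (WBρ ρ Wbar n a b) ^ s)
    (by positivity) (fun a => by positivity)
    (fun a b => mul_nonneg (by positivity) (Real.rpow_nonneg (hWB a b) s))
    (fun a b hab => by
      have hpow : (WBρ ρ Wbar n a b) ^ s
          ≤ M ^ s * ((2 / ρ) ^ s) ^ a * ((ρ⁻¹) ^ s) ^ (b - a) := by
        refine (Real.rpow_le_rpow (hWB a b)
          (WBρ_le (by linarith) hW.le n hab.le) hs0.le).trans_eq ?_
        rw [Real.mul_rpow (by positivity) (by positivity),
          Real.mul_rpow (by positivity) (by positivity),
          Real.rpow_pow_comm hq0.le, Real.rpow_pow_comm (by positivity)]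
      calc _ ≤ (1 + cs ^ s * M ^ s) * cs ^ s *
            (M ^ s * ((2 / ρ) ^ s) ^ a * ((ρ⁻¹) ^ s) ^ (b - a)) := by
            refine mul_le_mul ?_ hpow (Real.rpow_nonneg (hWB a b) s) (by positivity)
            gcongr
            exact hself a
        _ = D * ((2 / ρ) ^ s) ^ a * ((ρ⁻¹) ^ s) ^ (b - a) := by rw [hD]; ring)
    k n
  have hr : ((ρ⁻¹) ^ s) ^ (n - k) = ρ ^ (-(s * ((n - k : ℕ) : ℝ))) := by
    rw [Real.inv_rpow hρ0.le, inv_pow, Real.rpow_neg hρ0.le, Real.rpow_mul hρ0.le,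
      Real.rpow_natCast]
  rw [hr, mul_comm (ρ ^ _)] at hchain
  refine hchain.trans (mul_le_mul_of_nonneg_right ?_ (by positivity))
  exact prod_one_add_geometric_le hD0 (by positivity)
    (Real.rpow_lt_one hq0.le hq1 hs0) n
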